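/- For every ε > 0 there exists N such that for all even n ≥ N, the binary logarithm 𝒩(n) of the number of bent functions in n variables satisfies 𝒩(n) ≤ 𝒩₀(n−1,1) + (1/8 + ε)·2ⁿ, where 𝒩₀(n−1,1) is the binary logarithm of the number of (n−1)-variable 1-plateaued Boolean functions obtained by restricting n-variable bent functions to linear hyperplanes. -/

import Mathlib

/-- Inner product on 𝔽₂ⁿ. -/
def ip {n : ℕ} (x y : Fin n → ZMod 2) : ZMod 2 := ∑ i, x i * y i

/-- Walsh–Hadamard transform of a Boolean function. -/
def walsh {n : ℕ} (f : (Fin n → ZMod 2) → ZMod 2) (y : Fin n → ZMod 2) : ℤ :=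
  ∑ x, (-1 : ℤ) ^ (f x + ip x y).val

/-- `f` is bent: all Walsh coefficients are `±2^(n/2)`. -/
def IsBent {n : ℕ} (f : (Fin n → ZMod 2) → ZMod 2) : Prop :=
  ∀ y, walsh f y = 2 ^ (n / 2) ∨ walsh f y = -2 ^ (n / 2)

/-- `𝒩(n)`: the binary logarithm of the number of bent functions in `n` variables. -/
noncomputable def logNumBent (n : ℕ) : ℝ :=
  Real.logb 2 (Nat.card {f : (Fin n → ZMod 2) → ZMod 2 // IsBent f})

/-- `𝒩₀(m,1)`: the binary logarithm of the number of `m`-variable Boolean functions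
obtained by restricting `(m+1)`-variable bent functions to linear hyperplanes
(identified with 𝔽₂^m via a linear isomorphism). -/
noncomputable def logNumRestrictedBent (m : ℕ) : ℝ :=
  Real.logb 2 (Nat.card {g : (Fin m → ZMod 2) → ZMod 2 //
    ∃ (f : (Fin (m + 1) → ZMod 2) → ZMod 2)
      (H : Submodule (ZMod 2) (Fin (m + 1) → ZMod 2))
      (φ : (Fin m → ZMod 2) ≃ₗ[ZMod 2] H),
      IsBent f ∧ Module.finrank (ZMod 2) H = m ∧ ∀ x, g x = f ↑(φ x)})

open Finset

/-- Walsh transform of `F` on the cube `Finset α`. -/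
def cubeWalsh {α : Type*} [Fintype α] [DecidableEq α] (F : Finset α → ℤ) (v : Finset α) : ℤ :=
  ∑ u, F u * (-1) ^ #(u ∩ v)

theorem neg_one_pow_card_inter {α : Type*} [DecidableEq α] (u v : Finset α) :
    (-1 : ℤ) ^ #(u ∩ v) = ∏ i ∈ v, if i ∈ u then -1 else 1 := by
  rw [Finset.prod_ite, prod_const, prod_const_one, mul_one, filter_mem_eq_inter, inter_comm]

section Cube
variable {α : Type*} [Fintype α] [DecidableEq α]

theorem sum_neg_one_pow_card_inter_superset (x u : Finset α) :
    2 ^ #u * ∑ v with u ⊆ v, (-1 : ℤ) ^ #(x ∩ v) =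
      if x ⊆ u then 2 ^ Fintype.card α * (-1) ^ #x else 0 := by
  have h : ∑ v with u ⊆ v, (-1 : ℤ) ^ #(x ∩ v) =
      ∏ i : α, ((if i ∈ x then -1 else 1) + (if i ∈ u then (0 : ℤ) else 1)) := by
    rw [Finset.prod_add, powerset_univ, sum_filter]
    refine sum_congr rfl fun v _ => ?_
    rw [← neg_one_pow_card_inter]
    split_ifs with huv
    · rw [prod_eq_one, mul_one]
      intro i hi
      rw [if_neg fun hu => (mem_sdiff.1 hi).2 (huv hu)]
    · obtain ⟨i, hi, hv⟩ := not_subset.1 huv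
      rw [prod_eq_zero (i := i) (by simp [hv]) (by simp [hi]), mul_zero]
  have h2 : (2 : ℤ) ^ #u = ∏ i : α, if i ∈ u then 2 else 1 := by
    simp
  rw [h, h2, ← prod_mul_distrib]
  split_ifs with hx
  · have h3 : (-1 : ℤ) ^ #x = ∏ i : α, if i ∈ x then -1 else 1 := by
      simp
    rw [h3, ← card_univ, ← prod_const, ← prod_mul_distrib]
    refine prod_congr rfl fun i _ => ?_
    have := @hx i
    split_ifs <;> simp_all
  · obtain ⟨i, hi, hu⟩ := not_subset.1 hx
    exact prod_eq_zero (mem_univ i) (by simp [hi, hu])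

theorem sum_cubeWalsh_superset (F : Finset α → ℤ) (u : Finset α) :
    2 ^ #u * ∑ v with u ⊆ v, cubeWalsh F v =
      2 ^ Fintype.card α * ∑ x ∈ u.powerset, (-1) ^ #x * F x := by
  simp only [cubeWalsh]
  rw [sum_comm]
  simp only [← mul_sum]
  rw [mul_sum]
  calc ∑ x, 2 ^ #u * (F x * ∑ v with u ⊆ v, (-1 : ℤ) ^ #(x ∩ v))
      = ∑ x, F x * (if x ⊆ u then 2 ^ Fintype.card α * (-1) ^ #x else 0) :=
        sum_congr rfl fun x _ => by rw [← sum_neg_one_pow_card_inter_superset]; ring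
    _ = _ := by
        simp only [mul_ite, mul_zero]
        rw [← sum_filter, mul_sum]
        refine sum_congr (by ext; simp) fun x _ => by ring

theorem cubeWalsh_sub (F G : Finset α → ℤ) (v : Finset α) :
    cubeWalsh (F - G) v = cubeWalsh F v - cubeWalsh G v := by
  simp [cubeWalsh, sub_mul]

theorem eq_zero_of_cubeWalsh_eq_zero {F : Finset α → ℤ} (h : ∀ v, cubeWalsh F v = 0) : F = 0 := by
  funext u
  induction u using Finset.strongInduction with
  | H u ih =>
    have key := sum_cubeWalsh_superset F u
    rw [sum_eq_zero fun v _ => h v, mul_zero, eq_comm, mul_eq_zero_iff_left (by positivity),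
      sum_eq_single u (fun x hx hxu => ?_) (by simp)] at key
    · simpa using key
    · simp [ih x ((mem_powerset.1 hx).ssubset_of_ne hxu)]

theorem cubeWalsh_injective : Function.Injective (cubeWalsh (α := α)) := fun F G h =>
  sub_eq_zero.1 <| eq_zero_of_cubeWalsh_eq_zero fun v => by rw [cubeWalsh_sub, h, sub_self]

theorem sum_cubeWalsh_sq (F : Finset α → ℤ) :
    ∑ v, cubeWalsh F v ^ 2 = 2 ^ Fintype.card α * ∑ u, F u ^ 2 := by
  have orth (x y : Finset α) : ∑ v, (-1 : ℤ) ^ #(x ∩ v) * (-1) ^ #(y ∩ v) =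
      if x = y then 2 ^ Fintype.card α else 0 := by
    simp only [neg_one_pow_card_inter, ← prod_mul_distrib]
    rw [← powerset_univ, ← prod_one_add]
    split_ifs with h
    · subst h
      rw [← card_univ, ← prod_const]
      exact prod_congr rfl fun i _ => by split_ifs <;> norm_num
    · obtain ⟨i, hi⟩ : ∃ i, ¬(i ∈ x ↔ i ∈ y) := by
        by_contra! hc
        exact h (Finset.ext hc)
      refine prod_eq_zero (mem_univ i) ?_
      split_ifs <;> simp_all
  calc ∑ v, cubeWalsh F v ^ 2
      = ∑ v, ∑ x, ∑ y, F x * F y * ((-1 : ℤ) ^ #(x ∩ v) * (-1) ^ #(y ∩ v)) := by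
        refine sum_congr rfl fun v _ => ?_
        rw [sq, cubeWalsh, sum_mul_sum]
        exact sum_congr rfl fun x _ => sum_congr rfl fun y _ => by ring
    _ = ∑ x, ∑ y, F x * F y * (if x = y then 2 ^ Fintype.card α else 0) := by
        rw [sum_comm]
        refine sum_congr rfl fun x _ => ?_
        rw [sum_comm]
        exact sum_congr rfl fun y _ => by rw [← mul_sum, orth]
    _ = _ := by
        rw [mul_sum]
        exact sum_congr rfl fun x _ => by simp; ring

end Cube

/-- The monomial indexed by `u`, restricted to the points of `S`. -/
def monomialOn {α : Type*} [DecidableEq α] (S : Finset (Finset α)) (u : Finset α) : S → ZMod 2 :=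
  fun v => if u ⊆ v then 1 else 0

/-- The value of the binary expansion with digit set `u`. -/
def binaryValue {m : ℕ} (u : Finset (Fin m)) : ℕ := ∑ i ∈ u, 2 ^ (i : ℕ)

/-- `u` is standard for `S` if its monomial is not a combination, on `S`, of smaller ones. -/
def IsStandard {m : ℕ} (S : Finset (Finset (Fin m))) (u : Finset (Fin m)) : Prop :=
  monomialOn S u ∉ Submodule.span (ZMod 2) (monomialOn S '' {w | binaryValue w < binaryValue u})

theorem binaryValue_injective {m : ℕ} : Function.Injective (binaryValue (m := m)) := by
  intro u v h
  have := @Finset.geomSum_injective 2 le_rfl (u.map Fin.valEmbedding) (v.map Fin.valEmbedding)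
    (by simpa [binaryValue] using h)
  exact Finset.map_injective _ this

theorem monomialOn_union {α : Type*} [DecidableEq α] (S : Finset (Finset α)) (u w : Finset α) :
    monomialOn S (u ∪ w) = monomialOn S u * monomialOn S w := by
  funext v
  simp only [monomialOn, union_subset_iff, Pi.mul_apply]
  split_ifs <;> simp_all

theorem IsStandard.mono {m : ℕ} {S : Finset (Finset (Fin m))} {u w : Finset (Fin m)}
    (hw : IsStandard S w) (huw : u ⊆ w) : IsStandard S u := by
  intro hu
  refine hw ?_
  have h := Submodule.mem_map_of_mem (f := LinearMap.mulLeft (ZMod 2) (monomialOn S (w \ u))) hu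
  rw [LinearMap.mulLeft_apply, ← monomialOn_union, sdiff_union_of_subset huw,
    Submodule.map_span] at h
  refine Submodule.span_mono ?_ h
  rintro _ ⟨_, ⟨t, ht, rfl⟩, rfl⟩
  refine ⟨w \ u ∪ t, ?_, by rw [LinearMap.mulLeft_apply, monomialOn_union]⟩
  calc binaryValue (w \ u ∪ t) ≤ binaryValue (w \ u) + binaryValue t := by
        simp only [binaryValue]
        rw [← sum_union_inter]
        exact Nat.le_add_right _ _
    _ < binaryValue (w \ u) + binaryValue u := by gcongr; exact ht
    _ = binaryValue w := sum_sdiff huw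

theorem monomialOn_mem_span_standard {m : ℕ} (S : Finset (Finset (Fin m))) (u : Finset (Fin m)) :
    monomialOn S u ∈ Submodule.span (ZMod 2) (monomialOn S '' {w | IsStandard S w}) := by
  induction hk : binaryValue u using Nat.strong_induction_on generalizing u with
  | _ k ih =>
    by_cases hu : IsStandard S u
    · exact Submodule.subset_span ⟨u, hu, rfl⟩
    · refine Submodule.span_le.2 ?_ (not_not.1 hu)
      rintro _ ⟨w, hw, rfl⟩
      exact ih _ (hk ▸ hw) w rfl

theorem linearIndependent_standard {m : ℕ} (S : Finset (Finset (Fin m))) :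
    LinearIndependent (ZMod 2) fun u : {u // IsStandard S u} => monomialOn S u := by
  classical
  rw [Fintype.linearIndependent_iff]
  intro a ha
  by_contra! hne
  obtain ⟨u, hu, hmax⟩ := exists_max_image ({u | a u ≠ 0} : Finset {u // IsStandard S u})
    (fun u => binaryValue u.1) (by simpa [Finset.Nonempty] using hne)
  replace hu : a u ≠ 0 := by simpa using hu
  refine u.2 ?_
  rw [← Submodule.smul_mem_iff _ hu]
  rw [← add_sum_erase _ _ (mem_univ u), add_eq_zero_iff_eq_neg] at ha
  rw [ha]
  refine Submodule.neg_mem _ (Submodule.sum_mem _ fun w hw => ?_)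
  by_cases hw0 : a w = 0
  · simp [hw0]
  · refine Submodule.smul_mem _ _ (Submodule.subset_span ⟨w, ?_, rfl⟩)
    exact (hmax w (by simpa using hw0)).lt_of_ne fun h =>
      (mem_erase.1 hw).1 (Subtype.ext (binaryValue_injective h))

theorem card_standard_le {m : ℕ} (S : Finset (Finset (Fin m))) :
    Nat.card {u // IsStandard S u} ≤ #S := by
  classical
  simpa using (linearIndependent_standard S).fintype_card_le_finrank

theorem eq_zero_of_forall_standard {m : ℕ} {S : Finset (Finset (Fin m))} {c : S → ZMod 2}
    (h : ∀ u, IsStandard S u → ∑ v, c v * monomialOn S u v = 0) : c = 0 := by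
  have hall (u : Finset (Fin m)) : ∑ v, c v * monomialOn S u v = 0 := by
    have hu := monomialOn_mem_span_standard S u
    generalize monomialOn S u = p at hu ⊢
    induction hu using Submodule.span_induction with
    | mem x hx => obtain ⟨w, hw, rfl⟩ := hx; exact h w hw
    | zero => simp
    | add x y _ _ hx hy => simp only [Pi.add_apply, mul_add, sum_add_distrib, hx, hy, add_zero]
    | smul r x _ hx => simp only [Pi.smul_apply, smul_eq_mul, mul_left_comm _ r, ← mul_sum, hx, mul_zero]
  by_contra hne
  obtain ⟨v₀, hv₀⟩ := Function.ne_iff.1 hne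
  obtain ⟨v, hv, hmax⟩ := exists_max_image ({v | c v ≠ 0} : Finset S) (fun v => #v.1)
    ⟨v₀, by simpa using hv₀⟩
  replace hv : c v ≠ 0 := by simpa using hv
  have key := hall v
  rw [sum_eq_single v (fun w _ hw => ?_) (by simp)] at key
  · simp [monomialOn, hv] at key
  · by_cases hcw : c w = 0
    · simp [hcw]
    · have hsub : ¬(v.1 ⊆ w.1) := fun hs =>
        hw (Subtype.ext (eq_of_subset_of_card_le hs (hmax w (by simpa using hcw))).symm)
      simp [monomialOn, hsub]

theorem eq_zero_of_forall_standard_int {m : ℕ} {S : Finset (Finset (Fin m))}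
    {c : Finset (Fin m) → ℤ}
    (h : ∀ u, IsStandard S u → ∑ v ∈ S with u ⊆ v, c v = 0) : ∀ v ∈ S, c v = 0 := by
  have hdvd (k : ℕ) : ∀ c : Finset (Fin m) → ℤ,
      (∀ u, IsStandard S u → ∑ v ∈ S with u ⊆ v, c v = 0) → ∀ v ∈ S, (2 : ℤ) ^ k ∣ c v := by
    induction k with
    | zero => simp
    | succ k ih =>
      intro c hc
      have h2 : ∀ v ∈ S, c v = 2 * (c v / 2) := by
        have h0 : (fun v : S => (c v : ZMod 2)) = 0 := by
          refine eq_zero_of_forall_standard fun u hu => ?_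
          have := congrArg (Int.cast : ℤ → ZMod 2) (hc u hu)
          rw [sum_filter, ← sum_coe_sort] at this
          simpa [monomialOn] using this
        intro v hv
        have := congrFun h0 ⟨v, hv⟩
        have := (ZMod.intCast_zmod_eq_zero_iff_dvd (c v) 2).1 this
        grind
      have := ih (fun v => c v / 2) fun u hu => by
        have := hc u hu
        rw [sum_congr rfl fun v hv => h2 v (mem_filter.1 hv).1, ← mul_sum] at this
        simpa using this
      intro v hv
      rw [h2 v hv, pow_succ']
      exact mul_dvd_mul_left _ (this v hv)
  intro v hv
  by_contra hne
  have h1 := Int.le_of_dvd (abs_pos.2 hne) ((dvd_abs _ _).2 (hdvd (c v).natAbs c h v hv))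
  have h2 : ((c v).natAbs : ℤ) < 2 ^ (c v).natAbs := by exact_mod_cast Nat.lt_two_pow_self
  rw [Int.natCast_natAbs] at h2
  exact h1.not_gt h2

/-- The functions on the cube with values `±1` whose Walsh transform is `±2 ^ e` on `S` and
vanishes off `S`. -/
def plateauedOn {m : ℕ} (e : ℕ) (S : Finset (Finset (Fin m))) : Set (Finset (Fin m) → ℤ) :=
  {F | (∀ u, F u = 1 ∨ F u = -1) ∧ (∀ v ∉ S, cubeWalsh F v = 0) ∧
    ∀ v ∈ S, cubeWalsh F v = 2 ^ e ∨ cubeWalsh F v = -2 ^ e}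

section Plateaued
variable {m e : ℕ} {S : Finset (Finset (Fin m))} {F G : Finset (Fin m) → ℤ}

theorem card_of_plateauedOn (hm : m + 1 = 2 * e) (hF : F ∈ plateauedOn e S) :
    #S = 2 ^ (2 * e - 2) := by
  have h := sum_cubeWalsh_sq F
  have hl : ∑ v, cubeWalsh F v ^ 2 = #S * 2 ^ (2 * e) := by
    rw [← sum_subset (subset_univ S) fun v _ hv => by rw [hF.2.1 v hv]; rfl]
    rw [sum_congr rfl fun v hv => show cubeWalsh F v ^ 2 = 2 ^ (2 * e) by
      rcases hF.2.2 v hv with h | h <;> rw [h] <;> ring]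
    simp
  have hr : ∑ u, F u ^ 2 = 2 ^ m := by
    rw [sum_congr rfl fun u _ => show F u ^ 2 = 1 by rcases hF.1 u with h | h <;> rw [h] <;> rfl]
    simp
  rw [hl, hr, Fintype.card_fin, ← pow_add, show m + m = (2 * e - 2) + 2 * e by omega,
    pow_add] at h
  exact_mod_cast mul_right_cancel₀ (by positivity) h

theorem four_dvd_of_plateauedOn (hm : m + 1 = 2 * e) (hF : F ∈ plateauedOn e S)
    {u : Finset (Fin m)} (hu : e < #u) : (4 : ℤ) ∣ ∑ x ∈ u.powerset, (-1) ^ #x * F x := by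
  have h := sum_cubeWalsh_superset F u
  have hd : (2 : ℤ) ^ e ∣ ∑ v with u ⊆ v, cubeWalsh F v := by
    refine dvd_sum fun v _ => ?_
    by_cases hv : v ∈ S
    · rcases hF.2.2 v hv with h | h <;> simp [h]
    · simp [hF.2.1 v hv]
  obtain ⟨k, hk⟩ := hd
  rw [hk, Fintype.card_fin, ← mul_assoc, ← pow_add,
    show #u + e = m + 2 + (#u - e - 1) by omega, pow_add, pow_add, mul_assoc, mul_assoc] at h
  exact ⟨_, (mul_left_cancel₀ (by positivity) h).symm⟩

theorem eq_of_eq_on_standard_of_card_le (hm : m + 1 = 2 * e) (hF : F ∈ plateauedOn e S)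
    (hG : G ∈ plateauedOn e S) (h : ∀ u, IsStandard S u → #u ≤ e → F u = G u) : F = G := by
  have hst (u : Finset (Fin m)) : IsStandard S u → F u = G u := by
    induction u using Finset.strongInduction with
    | H u ih =>
      intro hu
      by_cases hue : #u ≤ e
      · exact h u hu hue
      have hd := dvd_sub (four_dvd_of_plateauedOn hm hF (not_le.1 hue))
        (four_dvd_of_plateauedOn hm hG (not_le.1 hue))
      rw [← sum_sub_distrib, sum_eq_single u (fun x hx hxu => ?_) (by simp)] at hd
      · rw [← mul_sub] at hd
        rcases neg_one_pow_eq_or ℤ #u with h1 | h1 <;> rw [h1] at hd <;>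
          rcases hF.1 u with h2 | h2 <;> rcases hG.1 u with h3 | h3 <;> rw [h2, h3] at hd ⊢ <;>
          omega
      · have hss := (mem_powerset.1 hx).ssubset_of_ne hxu
        rw [ih x hss (hu.mono hss.subset), sub_self]
  refine sub_eq_zero.1 (eq_zero_of_cubeWalsh_eq_zero fun v => ?_)
  by_cases hv : v ∈ S
  · refine eq_zero_of_forall_standard_int (S := S) (fun u hu => ?_) v hv
    have key := sum_cubeWalsh_superset (F - G) u
    rw [sum_eq_zero (s := u.powerset) fun x hx => by
      rw [Pi.sub_apply, hst x (hu.mono (mem_powerset.1 hx)), sub_self, mul_zero], mul_zero] at key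
    rw [← (mul_eq_zero_iff_left (by positivity)).1 key]
    refine sum_subset (filter_subset_filter _ (subset_univ S)) fun w hw hwS => ?_
    rw [cubeWalsh_sub, hF.2.1, hG.2.1, sub_self] <;> simp_all
  · rw [cubeWalsh_sub, hF.2.1 v hv, hG.2.1 v hv, sub_self]

/-- The indicator of the points of `S` at which the Walsh transform of `F` is negative. -/
def walshSign (S : Finset (Finset (Fin m))) (F : Finset (Fin m) → ℤ) (v : S) : ZMod 2 :=
  if cubeWalsh F v < 0 then 1 else 0

theorem sum_walshSign_sub_eq_zero (hm : m + 1 = 2 * e) (hF : F ∈ plateauedOn e S)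
    (hG : G ∈ plateauedOn e S) {u : Finset (Fin m)} (hu : #u + 2 ≤ e) :
    ∑ v, (walshSign S F - walshSign S G) v * monomialOn S u v = 0 := by
  let b (F : Finset (Fin m) → ℤ) (v : Finset (Fin m)) : ℤ := if cubeWalsh F v < 0 then 1 else 0
  have hb {F : Finset (Fin m) → ℤ} (hF : F ∈ plateauedOn e S) (v) (hv : v ∈ S) :
      cubeWalsh F v = 2 ^ e - 2 ^ (e + 1) * b F v := by
    have h0 : (0 : ℤ) < 2 ^ e := by positivity
    rcases hF.2.2 v hv with h | h
    · simp [b, h, not_lt.2 h0.le]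
    · simp [b, h, h0, pow_succ]; ring
  have hsum : ∑ v with u ⊆ v, cubeWalsh (F - G) v =
      2 ^ (e + 1) * ∑ v ∈ S with u ⊆ v, (b G v - b F v) := by
    rw [mul_sum, ← sum_subset (filter_subset_filter _ (subset_univ S)) fun w hw hwS => ?_]
    · refine sum_congr rfl fun v hv => ?_
      rw [cubeWalsh_sub, hb hF v (mem_filter.1 hv).1, hb hG v (mem_filter.1 hv).1]
      ring
    · rw [cubeWalsh_sub, hF.2.1, hG.2.1, sub_self] <;> simp_all
  have hdvd : (2 : ℤ) ∣ ∑ x ∈ u.powerset, (-1) ^ #x * (F - G) x := by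
    refine dvd_sum fun x _ => Dvd.dvd.mul_left ?_ _
    rw [Pi.sub_apply]
    rcases hF.1 x with h | h <;> rcases hG.1 x with h' | h' <;> rw [h, h'] <;> norm_num
  obtain ⟨k, hk⟩ := hdvd
  have key := sum_cubeWalsh_superset (F - G) u
  rw [hsum, hk, Fintype.card_fin, ← mul_assoc, ← mul_assoc, ← pow_add, ← pow_succ,
    show m + 1 = #u + (e + 1) + (e - #u - 2 + 1) by omega, pow_add _ _ (e - #u - 2 + 1),
    mul_assoc] at key
  have hev := mul_left_cancel₀ (by positivity) key
  rw [pow_succ', mul_assoc] at hev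
  have hz := congrArg (Int.cast : ℤ → ZMod 2) hev
  have h2 : ((2 : ℤ) : ZMod 2) = 0 := rfl
  rw [Int.cast_mul, h2, zero_mul, sum_filter, ← sum_coe_sort, Int.cast_sum] at hz
  rw [← neg_eq_zero, ← hz, ← sum_neg_distrib]
  refine sum_congr rfl fun v _ => ?_
  simp only [monomialOn, walshSign, Pi.sub_apply, b]
  split_ifs <;> simp

theorem eq_of_sum_walshSign_eq (hm : m + 1 = 2 * e) (hF : F ∈ plateauedOn e S)
    (hG : G ∈ plateauedOn e S)
    (h : ∀ u, IsStandard S u → e < #u + 2 → ∑ v, walshSign S F v * monomialOn S u v =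
      ∑ v, walshSign S G v * monomialOn S u v) : F = G := by
  have hs : walshSign S F - walshSign S G = 0 := eq_zero_of_forall_standard fun u hu => by
    by_cases hue : #u + 2 ≤ e
    · exact sum_walshSign_sub_eq_zero hm hF hG hue
    · simp only [Pi.sub_apply, sub_mul, sum_sub_distrib]
      rw [h u hu (not_le.1 hue), sub_self]
  refine cubeWalsh_injective (funext fun v => ?_)
  by_cases hv : v ∈ S
  · have hsv := congrFun (sub_eq_zero.1 hs) ⟨v, hv⟩
    have h0 : (0 : ℤ) < 2 ^ e := by positivity
    rcases hF.2.2 v hv with h1 | h1 <;> rcases hG.2.2 v hv with h2 | h2 <;>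
      simp [walshSign, h1, h2, h0, not_lt.2 h0.le] at hsv ⊢
  · rw [hF.2.1 v hv, hG.2.1 v hv]

theorem card_plateauedOn_sq_le (hm : m + 1 = 2 * e) (S : Finset (Finset (Fin m))) :
    Nat.card (plateauedOn e S) ^ 2 ≤ 2 ^ (2 ^ (2 * e - 2) + e.centralBinom) := by
  classical
  rcases (plateauedOn e S).eq_empty_or_nonempty with h | ⟨F₀, hF₀⟩
  · simp [h]
  let Δ : Finset (Finset (Fin m)) := {u | IsStandard S u}
  let A := Δ.filter fun u => #u ≤ e
  let B := Δ.filter fun u => e < #u + 2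
  have hA : Nat.card (plateauedOn e S) ≤ 2 ^ #A := by
    have := Nat.card_le_card_of_injective
      (fun (F : plateauedOn e S) (u : A) => decide (F.1 u = 1)) fun F G hFG => by
        refine Subtype.ext (eq_of_eq_on_standard_of_card_le hm F.2 G.2 fun u hu hue => ?_)
        have h := congrFun hFG ⟨u, by simp [A, Δ, hu, hue]⟩
        rcases F.2.1 u with h1 | h1 <;> rcases G.2.1 u with h2 | h2 <;> simp_all
    simpa using this
  have hB : Nat.card (plateauedOn e S) ≤ 2 ^ #B := by
    have := Nat.card_le_card_of_injective
      (fun (F : plateauedOn e S) (u : B) => ∑ v, walshSign S F v * monomialOn S u v)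
      fun F G hFG => Subtype.ext (eq_of_sum_walshSign_eq hm F.2 G.2 fun u hu hue =>
        congrFun hFG ⟨u, by simp [B, Δ, hu, hue]⟩)
    simpa using this
  have hΔ : #Δ ≤ 2 ^ (2 * e - 2) := by
    rw [← card_of_plateauedOn hm hF₀]
    simpa [Δ, Fintype.card_subtype] using card_standard_le S
  have hAB : #(A ∩ B) ≤ e.centralBinom := by
    obtain ⟨k, rfl⟩ : ∃ k, e = k + 1 := ⟨e - 1, by omega⟩
    calc #(A ∩ B) ≤ #(powersetCard k (univ : Finset (Fin m)) ∪ powersetCard (k + 1) univ) := by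
          refine card_le_card fun u hu => ?_
          simp only [A, B, mem_inter, mem_filter, mem_union, mem_powersetCard_univ] at hu ⊢
          omega
      _ ≤ m.choose k + m.choose (k + 1) := by
          simpa using card_union_le (powersetCard k (univ : Finset (Fin m)))
            (powersetCard (k + 1) univ)
      _ = (k + 1).centralBinom := by
          rw [Nat.centralBinom, ← hm, Nat.choose_succ_succ]
  calc Nat.card (plateauedOn e S) ^ 2 ≤ 2 ^ #A * 2 ^ #B := by
        rw [sq]; exact Nat.mul_le_mul hA hB
    _ = 2 ^ (#(A ∪ B) + #(A ∩ B)) := by rw [card_union_add_card_inter, pow_add]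
    _ ≤ _ := by
        gcongr
        · norm_num
        · exact (card_le_card (union_subset (filter_subset _ _) (filter_subset _ _))).trans hΔ

end Plateaued

theorem neg_one_pow_val_add (a b : ZMod 2) :
    (-1 : ℤ) ^ (a + b).val = (-1) ^ a.val * (-1) ^ b.val := by
  decide +revert

theorem walsh_cons {m : ℕ} (f : (Fin (m + 1) → ZMod 2) → ZMod 2) (c : ZMod 2)
    (y : Fin m → ZMod 2) :
    walsh f (Fin.cons c y) = walsh (fun x => f (Fin.cons 0 x)) y +
      (-1) ^ c.val * walsh (fun x => f (Fin.cons 1 x)) y := by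
  simp only [walsh, ip]
  rw [← (Fin.consEquiv fun _ => ZMod 2).sum_comp, Fintype.sum_prod_type]
  have h (g : ZMod 2 → ℤ) : ∑ a, g a = g 0 + g 1 := Fin.sum_univ_two g
  rw [h]
  simp only [Fin.consEquiv_apply, Fin.sum_univ_succ, Fin.cons_zero, Fin.cons_succ, zero_mul,
    zero_add, one_mul, mul_sum, neg_one_pow_val_add]
  congr 1
  exact sum_congr rfl fun x _ => by rw [mul_left_comm]; rfl

/-- The subsets of `α` as points of the cube. -/
def indicatorEquiv (α : Type*) [Fintype α] [DecidableEq α] : Finset α ≃ (α → ZMod 2) where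
  toFun u i := if i ∈ u then 1 else 0
  invFun x := {i | x i = 1}
  left_inv u := by ext; simp
  right_inv x := by
    funext i
    generalize hx : x i = a
    simp only [mem_filter, mem_univ, true_and, hx]
    clear hx
    revert a
    decide

/-- The `±1`-valued function on the cube attached to a Boolean function. -/
def signOn {m : ℕ} (h : (Fin m → ZMod 2) → ZMod 2) (u : Finset (Fin m)) : ℤ :=
  (-1) ^ (h (indicatorEquiv _ u)).val

theorem signOn_injective {m : ℕ} : Function.Injective (signOn (m := m)) := by
  intro g h hgh
  funext x
  have := congrFun hgh ((indicatorEquiv _).symm x)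
  simp only [signOn, Equiv.apply_symm_apply] at this
  generalize g x = a at *
  generalize h x = b at *
  decide +revert

theorem walsh_indicator {m : ℕ} (h : (Fin m → ZMod 2) → ZMod 2) (v : Finset (Fin m)) :
    walsh h (indicatorEquiv _ v) = cubeWalsh (signOn h) v := by
  simp only [walsh, cubeWalsh]
  rw [← (indicatorEquiv _).sum_comp]
  refine sum_congr rfl fun u _ => ?_
  rw [neg_one_pow_val_add, signOn]
  congr 1
  have h1 : ip (indicatorEquiv _ u) (indicatorEquiv _ v) = (#(u ∩ v) : ZMod 2) := by
    simp [ip, indicatorEquiv, inter_comm]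
  rw [h1, ZMod.val_natCast, ← neg_one_pow_eq_pow_mod_two]

theorem IsBent.signOn_mem_plateauedOn {m e : ℕ} (hm : m + 1 = 2 * e)
    {f : (Fin (m + 1) → ZMod 2) → ZMod 2} (hf : IsBent f) :
    signOn (fun x => f (Fin.cons 1 x)) ∈
      plateauedOn e {v | cubeWalsh (signOn fun x => f (Fin.cons 0 x)) v = 0} := by
  refine ⟨fun u => neg_one_pow_eq_or _ _, ?_⟩
  have he : (m + 1) / 2 = e := by omega
  have h0 : (0 : ℤ) < 2 ^ e := by positivity
  have key (v : Finset (Fin m)) := And.intro (hf (Fin.cons 0 (indicatorEquiv _ v)))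
    (hf (Fin.cons 1 (indicatorEquiv _ v)))
  simp only [walsh_cons, walsh_indicator, he, ZMod.val_zero, pow_zero, one_mul,
    ZMod.val_one, pow_one] at key
  constructor <;> intro v hv <;> have := key v <;> simp at hv <;> omega

/-- A bound for the number of bent functions extending a given function on the hyperplane
`x 0 = 0`. -/
theorem card_bent_extension_sq_le {m e : ℕ} (hm : m + 1 = 2 * e)
    (g : (Fin m → ZMod 2) → ZMod 2) :
    Nat.card {f : (Fin (m + 1) → ZMod 2) → ZMod 2 //
      IsBent f ∧ (fun x => f (Fin.cons 0 x)) = g} ^ 2 ≤ 2 ^ (2 ^ (2 * e - 2) + e.centralBinom) := by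
  refine le_trans ?_ (card_plateauedOn_sq_le hm {v | cubeWalsh (signOn g) v = 0})
  have : Finite (plateauedOn e {v | cubeWalsh (signOn g) v = 0}) := by
    refine Set.Finite.subset (Set.Finite.pi' fun _ => Set.toFinite {1, -1}) fun F hF u => ?_
    simpa using hF.1 u
  gcongr
  refine Nat.card_le_card_of_injective (fun f => ⟨_, f.2.2 ▸ f.2.1.signOn_mem_plateauedOn hm⟩)
    fun f f' h => Subtype.ext ?_
  have h1 := @signOn_injective _ (fun x => f.1 (Fin.cons 1 x)) (fun x => f'.1 (Fin.cons 1 x))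
    (congrArg Subtype.val h)
  have h0 := f.2.2.trans f'.2.2.symm
  funext x
  rw [← Fin.cons_self_tail x]
  obtain h2 | h2 : x 0 = 0 ∨ x 0 = 1 := by
    generalize x 0 = a
    revert a
    decide
  · rw [h2]
    exact congrFun h0 (Fin.tail x)
  · rw [h2]
    exact congrFun h1 (Fin.tail x)

/-- The functions counted by `logNumRestrictedBent`. -/
def IsRestrictedBent {m : ℕ} (g : (Fin m → ZMod 2) → ZMod 2) : Prop :=
  ∃ (f : (Fin (m + 1) → ZMod 2) → ZMod 2) (H : Submodule (ZMod 2) (Fin (m + 1) → ZMod 2))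
    (φ : (Fin m → ZMod 2) ≃ₗ[ZMod 2] H),
    IsBent f ∧ Module.finrank (ZMod 2) H = m ∧ ∀ x, g x = f ↑(φ x)

theorem IsBent.isRestrictedBent_cons_zero {m : ℕ} {f : (Fin (m + 1) → ZMod 2) → ZMod 2}
    (hf : IsBent f) : IsRestrictedBent fun x : Fin m → ZMod 2 => f (Fin.cons 0 x) := by
  let ι : (Fin m → ZMod 2) →ₗ[ZMod 2] (Fin (m + 1) → ZMod 2) :=
    { toFun := fun x => Fin.cons 0 x
      map_add' := fun x y => by
        funext i
        refine Fin.cases ?_ (fun j => ?_) i <;> simp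
      map_smul' := fun c x => by
        funext i
        refine Fin.cases ?_ (fun j => ?_) i <;> simp }
  have hι : Function.Injective ι := Fin.cons_right_injective (α := fun _ => ZMod 2) 0
  refine ⟨f, LinearMap.range ι, LinearEquiv.ofInjective ι hι, hf, ?_, fun x => rfl⟩
  rw [LinearMap.finrank_range_of_inj hι, Module.finrank_fin_fun]

theorem card_bent_sq_le {m e : ℕ} (hm : m + 1 = 2 * e) :
    Nat.card {f : (Fin (m + 1) → ZMod 2) → ZMod 2 // IsBent f} ^ 2 ≤
      Nat.card {g : (Fin m → ZMod 2) → ZMod 2 // IsRestrictedBent g} ^ 2 *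
        2 ^ (2 ^ (2 * e - 2) + e.centralBinom) := by
  classical
  set P := 2 ^ (2 ^ (2 * e - 2) + e.centralBinom)
  let s : Finset ((Fin (m + 1) → ZMod 2) → ZMod 2) := {f | IsBent f}
  let r (f : (Fin (m + 1) → ZMod 2) → ZMod 2) (x : Fin m → ZMod 2) : ZMod 2 := f (Fin.cons 0 x)
  have hfib (g : (Fin m → ZMod 2) → ZMod 2) : #{f ∈ s | r f = g} ≤ P.sqrt := by
    rw [Nat.le_sqrt']
    convert card_bent_extension_sq_le hm g using 2
    rw [Nat.card_eq_fintype_card, Fintype.card_subtype, filter_filter]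
  have himg : s.image r ⊆ ({g | IsRestrictedBent g} : Finset ((Fin m → ZMod 2) → ZMod 2)) := by
    simp only [s, image_subset_iff, mem_filter, mem_univ, true_and]
    exact fun f hf => hf.isRestrictedBent_cons_zero
  simp only [Nat.card_eq_fintype_card, Fintype.card_subtype]
  calc #s ^ 2 ≤ (P.sqrt * #({g | IsRestrictedBent g} : Finset ((Fin m → ZMod 2) → ZMod 2))) ^ 2 := by
        gcongr
        exact (card_le_mul_card_image s _ fun g _ => hfib g).trans
          (Nat.mul_le_mul_left _ (card_le_card himg))
    _ = _ * P.sqrt ^ 2 := by rw [mul_pow, mul_comm]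
    _ ≤ _ := Nat.mul_le_mul_left _ (Nat.sqrt_le' P)

theorem centralBinom_sq_mul_le (k : ℕ) : k.centralBinom ^ 2 * (2 * k + 1) ≤ 16 ^ k := by
  induction k with
  | zero => simp
  | succ k ih =>
    have h := Nat.succ_mul_centralBinom_succ k
    refine Nat.le_of_mul_le_mul_left (c := (k + 1) ^ 2) ?_ (by positivity)
    calc (k + 1) ^ 2 * ((k + 1).centralBinom ^ 2 * (2 * (k + 1) + 1))
        = ((k + 1) * (k + 1).centralBinom) ^ 2 * (2 * k + 3) := by ring
      _ = 4 * ((2 * k + 1) * (2 * k + 3)) * (k.centralBinom ^ 2 * (2 * k + 1)) := by rw [h]; ring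
      _ ≤ 4 * (4 * (k + 1) ^ 2) * 16 ^ k := by
          have : (2 * k + 1) * (2 * k + 3) ≤ 4 * (k + 1) ^ 2 := by nlinarith
          exact Nat.mul_le_mul (Nat.mul_le_mul_left _ this) ih
      _ = (k + 1) ^ 2 * 16 ^ (k + 1) := by ring

theorem eventually_centralBinom_le {ε : ℝ} (hε : 0 < ε) :
    ∃ N : ℕ, ∀ k ≥ N, (k.centralBinom : ℝ) ≤ ε * 4 ^ k := by
  obtain ⟨N, hN⟩ := exists_nat_ge (1 / ε ^ 2)
  refine ⟨N, fun k hk => le_of_pow_le_pow_left₀ two_ne_zero (by positivity) ?_⟩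
  have hk' : (1 : ℝ) ≤ ε ^ 2 * (2 * k + 1) := by
    rw [div_le_iff₀ (by positivity)] at hN
    have : (N : ℝ) ≤ k := by exact_mod_cast hk
    nlinarith [sq_pos_of_pos hε]
  have h : (k.centralBinom : ℝ) ^ 2 * (2 * k + 1) ≤ 16 ^ k := by
    exact_mod_cast centralBinom_sq_mul_le k
  calc (k.centralBinom : ℝ) ^ 2 ≤ k.centralBinom ^ 2 * (ε ^ 2 * (2 * k + 1)) :=
        le_mul_of_one_le_right (by positivity) hk'
    _ = ε ^ 2 * (k.centralBinom ^ 2 * (2 * k + 1)) := by ring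
    _ ≤ ε ^ 2 * 16 ^ k := by gcongr
    _ = (ε * 4 ^ k) ^ 2 := by rw [mul_pow, ← pow_mul, mul_comm k, pow_mul]; norm_num

/-- Asymptotic upper bound `𝒩(n) ≤ 𝒩₀(n-1,1) + 2^{n-3}(1 + o(1))`
(note `2^{n-3} = (1/8)·2ⁿ`). -/
theorem logNumBent_le_restricted_add :
    ∀ ε > (0 : ℝ), ∃ N : ℕ, ∀ n ≥ N, n % 2 = 0 →
      logNumBent n ≤ logNumRestrictedBent (n - 1) + (1 / 8 + ε) * 2 ^ n := by
  intro ε hε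
  obtain ⟨N, hN⟩ := eventually_centralBinom_le hε
  refine ⟨2 * N + 2, fun n hn hn2 => ?_⟩
  obtain ⟨m, rfl⟩ : ∃ m, n = m + 1 := ⟨n - 1, by omega⟩
  obtain ⟨e, he⟩ : ∃ e, m + 1 = 2 * e := ⟨(m + 1) / 2, by omega⟩
  have hcard := card_bent_sq_le he
  have hbin := hN e (by omega)
  have hpow : (2 : ℝ) ^ (2 * e - 2) = 2 ^ (m + 1) / 4 := by
    rw [he, show 2 * e = 2 * e - 2 + 2 by omega, pow_add, Nat.add_sub_cancel]
    norm_num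
  have h4 : (4 : ℝ) ^ e = 2 ^ (m + 1) := by rw [he, pow_mul]; norm_num
  rw [Nat.add_sub_cancel]
  change Real.logb 2 _ ≤
    Real.logb 2 (Nat.card {g : (Fin m → ZMod 2) → ZMod 2 // IsRestrictedBent g}) + _
  rcases Nat.eq_zero_or_pos (Nat.card {f : (Fin (m + 1) → ZMod 2) → ZMod 2 // IsBent f})
    with h0 | h0
  · rw [h0, Nat.cast_zero, Real.logb_zero]
    have : 0 ≤ Real.logb 2 (Nat.card {g : (Fin m → ZMod 2) → ZMod 2 // IsRestrictedBent g}) :=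
      div_nonneg (Real.log_natCast_nonneg _) (Real.log_nonneg one_le_two)
    positivity
  · have hr : 0 < Nat.card {g : (Fin m → ZMod 2) → ZMod 2 // IsRestrictedBent g} := by
      refine Nat.pos_of_ne_zero fun hr => ?_
      rw [hr, zero_pow two_ne_zero, zero_mul] at hcard
      exact (pow_pos h0 2).not_ge hcard
    have hlog := Real.logb_le_logb_of_le (b := 2) one_lt_two (by positivity)
      (Nat.cast_le (α := ℝ).2 hcard)
    push_cast at hlog
    rw [Real.logb_mul (by positivity) (by positivity), Real.logb_pow, Real.logb_pow,
      Real.logb_pow, Real.logb_self_eq_one one_lt_two] at hlog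
    push_cast at hlog
    rw [hpow] at hlog
    rw [h4] at hbin
    have : 0 < ε * 2 ^ (m + 1) := by positivity
    linarith
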